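/- arXiv:2502.00770 — 3 statements merged into one kernel-verified Lean document; each statement's English description precedes it below -/
import Mathlib

section
/- Let K/F be a cyclic Galois field extension of degree n ≥ 3 and let σ₁ and σ₂ be distinct generators of Gal(K/F), so that σ₁ = σ₂^j for some j with 1 < j < n and gcd(j,n) = 1. Let f ∈ K[t;σ₁] and g ∈ K[t;σ₂] be monic of degree m with n < m−1, neither of them right-invariant, and let H : S_f → S_g be an F-algebra isomorphism between the (proper nonassociative) Petit algebras. Then H maps constant polynomials to constant polynomials, the induced map on K is an element τ ∈ Gal(K/F), and writing H(t) = Σ_{i=0}^{m−1} k_i t^i with k_i ∈ K, one has k_i = 0 for every index i with i ≢ j (mod n); that is, H(t) = k_j t^j + k_{n+j} t^{n+j} + ⋯ + k_{sn+j} t^{sn+j}, where s is the largest integer with sn + j ≤ m−1. -/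
/-- Multiplication of the twisted polynomial ring `K[t;σ]`, on the space
`ℕ →₀ K` of finitely supported coefficient sequences: determined by
`t·c = σ(c)·t`, i.e. `(a t^i)(b t^j) = a σ^i(b) t^{i+j}`. -/
noncomputable def tmul {F K : Type*} [Field F] [Field K] [Algebra F K]
    (σ : K ≃ₐ[F] K) (p q : ℕ →₀ K) : ℕ →₀ K :=
  p.sum fun i a => q.sum fun j b => Finsupp.single (i + j) (a * (σ ^ i) b)

/-- The twisted polynomial `p` has degree `< m`. -/
def DegLt {K : Type*} [Field K] (m : ℕ) (p : ℕ →₀ K) : Prop :=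
  ∀ i : ℕ, m ≤ i → p i = 0

/-- The twisted polynomial `p` is monic of degree `m`. -/
def TMonic {K : Type*} [Field K] (m : ℕ) (p : ℕ →₀ K) : Prop :=
  p m = 1 ∧ ∀ i : ℕ, m < i → p i = 0

/-- `f` is right-invariant: the left ideal `K[t;σ]f` is a two-sided ideal,
i.e. it is closed under right multiplication. -/
def RightInvariant {F K : Type*} [Field F] [Field K] [Algebra F K]
    (σ : K ≃ₐ[F] K) (f : ℕ →₀ K) : Prop :=
  ∀ q g : ℕ →₀ K, ∃ q' : ℕ →₀ K, tmul σ (tmul σ q f) g = tmul σ q' f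

/-- `mul` is the multiplication of the Petit algebra
`S_f = K[t;σ]/K[t;σ]f` on polynomials of degree `< m`:
`mul p q` is the remainder of `p·q` after right division by `f`. -/
def IsPetitMul {F K : Type*} [Field F] [Field K] [Algebra F K]
    (σ : K ≃ₐ[F] K) (m : ℕ) (f : ℕ →₀ K)
    (mul : (ℕ →₀ K) → (ℕ →₀ K) → (ℕ →₀ K)) : Prop :=
  ∀ p q : ℕ →₀ K, DegLt m p → DegLt m q →
    DegLt m (mul p q) ∧ ∃ s : ℕ →₀ K, tmul σ p q = tmul σ s f + mul p q


section TwistedPolynomial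

variable {F K : Type*} [Field F] [Field K] [Algebra F K]

lemma tmul_single_single (σ : K ≃ₐ[F] K) (i j : ℕ) (a b : K) :
    tmul σ (Finsupp.single i a) (Finsupp.single j b)
      = Finsupp.single (i + j) (a * (σ ^ i) b) := by
  simp [tmul]

lemma zero_tmul (σ : K ≃ₐ[F] K) (q : ℕ →₀ K) : tmul σ 0 q = 0 := by
  simp [tmul]

lemma tmul_zero (σ : K ≃ₐ[F] K) (p : ℕ →₀ K) : tmul σ p 0 = 0 := by
  simp [tmul]

lemma add_tmul (σ : K ≃ₐ[F] K) (p p' q : ℕ →₀ K) :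
    tmul σ (p + p') q = tmul σ p q + tmul σ p' q := by
  unfold tmul
  apply Finsupp.sum_add_index'
  · simp
  · intro i a b
    simp [add_mul, Finsupp.sum_add]

lemma tmul_add (σ : K ≃ₐ[F] K) (p q q' : ℕ →₀ K) :
    tmul σ p (q + q') = tmul σ p q + tmul σ p q' := by
  unfold tmul
  rw [← Finsupp.sum_add]
  refine Finsupp.sum_congr fun i _ => ?_
  apply Finsupp.sum_add_index'
  · simp
  · intro j a b
    simp [mul_add]

lemma sub_tmul (σ : K ≃ₐ[F] K) (p p' q : ℕ →₀ K) :
    tmul σ (p - p') q = tmul σ p q - tmul σ p' q := by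
  rw [eq_sub_iff_add_eq, ← add_tmul, sub_add_cancel]

lemma tmul_assoc (σ : K ≃ₐ[F] K) (p q r : ℕ →₀ K) :
    tmul σ (tmul σ p q) r = tmul σ p (tmul σ q r) := by
  induction p using Finsupp.induction_linear with
  | zero => simp [zero_tmul]
  | add p p' hp hp' => simp [add_tmul, hp, hp']
  | single i a =>
    induction q using Finsupp.induction_linear with
    | zero => simp [zero_tmul, tmul_zero]
    | add q q' hq hq' => simp [add_tmul, tmul_add, hq, hq']
    | single j b =>
      induction r using Finsupp.induction_linear with
      | zero => simp [tmul_zero]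
      | add r r' hr hr' => simp [tmul_add, hr, hr']
      | single k c =>
        simp only [tmul_single_single, add_assoc, pow_add, mul_assoc, map_mul, AlgEquiv.mul_apply]

lemma one_tmul (σ : K ≃ₐ[F] K) (p : ℕ →₀ K) :
    tmul σ (Finsupp.single 0 1) p = p := by
  induction p using Finsupp.induction_linear with
  | zero => exact tmul_zero σ _
  | add p q hp hq => rw [tmul_add, hp, hq]
  | single i a => simp only [tmul_single_single, zero_add, pow_zero, AlgEquiv.one_apply, one_mul]

lemma tmul_apply (σ : K ≃ₐ[F] K) (p q : ℕ →₀ K) (k : ℕ) :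
    tmul σ p q k = p.sum fun i a => q.sum fun j b => if i + j = k then a * (σ ^ i) b else 0 := by
  simp only [tmul, Finsupp.sum, Finsupp.finsetSum_apply, Finsupp.single_apply]

lemma DegLt.tmul {σ : K ≃ₐ[F] K} {p q : ℕ →₀ K} {d e k : ℕ}
    (hp : DegLt (d + 1) p) (hq : DegLt (e + 1) q) (hk : d + e < k) :
    DegLt k (tmul σ p q) := by
  intro l hl
  rw [tmul_apply]
  refine Finset.sum_eq_zero fun i hi => Finset.sum_eq_zero fun j hj => if_neg ?_
  have hid : ¬ d + 1 ≤ i := fun h => Finsupp.mem_support_iff.1 hi (hp i h)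
  have hje : ¬ e + 1 ≤ j := fun h => Finsupp.mem_support_iff.1 hj (hq j h)
  omega

lemma tmul_apply_add_of_degLt (σ : K ≃ₐ[F] K) {p q : ℕ →₀ K} {d e : ℕ}
    (hp : DegLt (d + 1) p) (hq : DegLt (e + 1) q) :
    tmul σ p q (d + e) = p d * (σ ^ d) (q e) := by
  rw [tmul_apply, Finsupp.sum, Finset.sum_eq_single d, Finsupp.sum, Finset.sum_eq_single e]
  · simp
  · intro j _ hj
    exact if_neg (by omega)
  · intro h
    simp [Finsupp.notMem_support_iff.1 h]
  · intro i hi hid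
    refine Finset.sum_eq_zero fun j hj => if_neg ?_
    have hid : ¬ d + 1 ≤ i := fun h => Finsupp.mem_support_iff.1 hi (hp i h)
    have hje : ¬ e + 1 ≤ j := fun h => Finsupp.mem_support_iff.1 hj (hq j h)
    omega
  · intro h
    simp [Finsupp.notMem_support_iff.1 h]

lemma single_zero_tmul_apply (σ : K ≃ₐ[F] K) (c : K) (p : ℕ →₀ K) (i : ℕ) :
    tmul σ (Finsupp.single 0 c) p i = c * p i := by
  induction p using Finsupp.induction_linear with
  | zero => simp [tmul_zero]
  | add p q hp hq => simp [tmul_add, hp, hq, mul_add]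
  | single j b => by_cases h : j = i <;> simp [tmul_single_single, h]

lemma tmul_single_zero_apply (σ : K ≃ₐ[F] K) (c : K) (p : ℕ →₀ K) (i : ℕ) :
    tmul σ p (Finsupp.single 0 c) i = p i * (σ ^ i) c := by
  induction p using Finsupp.induction_linear with
  | zero => simp [zero_tmul]
  | add p q hp hq => simp [add_tmul, hp, hq, add_mul]
  | single j b =>
    by_cases h : j = i <;> simp [tmul_single_single, h]

lemma exists_apply_ne_zero_degLt {p : ℕ →₀ K} (hp : p ≠ 0) :
    ∃ d, p d ≠ 0 ∧ DegLt (d + 1) p := by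
  have hne : p.support.Nonempty := Finsupp.support_nonempty_iff.2 hp
  refine ⟨p.support.max' hne, Finsupp.mem_support_iff.1 (p.support.max'_mem hne), ?_⟩
  intro i hi
  by_contra h
  have := p.support.le_max' i (Finsupp.mem_support_iff.2 h)
  omega

lemma degLt_single {m i : ℕ} (hi : i < m) (c : K) : DegLt m (Finsupp.single i c) := by
  intro k hk
  rw [Finsupp.single_apply, if_neg (by omega)]

lemma degLt_zero (m : ℕ) : DegLt m (0 : ℕ →₀ K) := fun _ _ => rfl

lemma DegLt.sub {m : ℕ} {p q : ℕ →₀ K} (hp : DegLt m p) (hq : DegLt m q) :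
    DegLt m (p - q) := fun i hi => by simp [hp i hi, hq i hi]

lemma DegLt.mono {m k : ℕ} {p : ℕ →₀ K} (hp : DegLt m p) (h : m ≤ k) : DegLt k p :=
  fun i hi => hp i (h.trans hi)

lemma DegLt.eq_single_zero {p : ℕ →₀ K} (hp : DegLt 1 p) : p = Finsupp.single 0 (p 0) := by
  ext i
  rcases Nat.eq_zero_or_pos i with rfl | hi
  · simp
  · rw [hp i hi, Finsupp.single_apply, if_neg (by omega)]

lemma DegLt.single_zero_tmul {σ : K ≃ₐ[F] K} {m : ℕ} {p : ℕ →₀ K} (hp : DegLt m p) (c : K) :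
    DegLt m (_root_.tmul σ (Finsupp.single 0 c) p) := fun i hi => by
  rw [single_zero_tmul_apply, hp i hi, mul_zero]

lemma DegLt.tmul_single_zero {σ : K ≃ₐ[F] K} {m : ℕ} {p : ℕ →₀ K} (hp : DegLt m p) (c : K) :
    DegLt m (_root_.tmul σ p (Finsupp.single 0 c)) := fun i hi => by
  rw [tmul_single_zero_apply, hp i hi, zero_mul]

lemma TMonic.degLt_of_tmul {σ : K ≃ₐ[F] K} {m k : ℕ} {f s : ℕ →₀ K} (hf : TMonic m f)
    (h : DegLt (m + k) (tmul σ s f)) : DegLt k s := by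
  by_cases hs : s = 0
  · exact hs ▸ degLt_zero k
  obtain ⟨d, hd, hdeg⟩ := exists_apply_ne_zero_degLt hs
  refine hdeg.mono ?_
  by_contra hdk
  apply hd
  have := h (d + m) (by omega)
  rwa [tmul_apply_add_of_degLt σ hdeg (fun i hi => hf.2 i hi), hf.1, map_one, mul_one] at this

lemma TMonic.remainder_unique {σ : K ≃ₐ[F] K} {m : ℕ} {f s s' r r' : ℕ →₀ K}
    (hf : TMonic m f) (hr : DegLt m r) (hr' : DegLt m r')
    (h : tmul σ s f + r = tmul σ s' f + r') : r = r' := by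
  have h₁ : tmul σ (s - s') f = r' - r := by
    rw [sub_tmul, sub_eq_sub_iff_add_eq_add, h, add_comm]
  have h₂ : DegLt 0 (s - s') := hf.degLt_of_tmul (σ := σ) (h₁ ▸ hr'.sub hr)
  have h₃ : s - s' = 0 := Finsupp.ext fun i => h₂ i (Nat.zero_le i)
  rw [h₃, zero_tmul] at h₁
  exact (sub_eq_zero.1 h₁.symm).symm

lemma rightInvariant_of_forall_degLt {σ : K ≃ₐ[F] K} {m : ℕ} (hm : 2 ≤ m) {f : ℕ →₀ K}
    (h : ∀ r : ℕ →₀ K, DegLt m r → ∃ q : ℕ →₀ K, tmul σ f r = tmul σ q f) :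
    RightInvariant σ f := by
  have hmul : ∀ r r' : ℕ →₀ K, (∃ q, tmul σ f r = tmul σ q f) →
      (∃ q, tmul σ f r' = tmul σ q f) → ∃ q, tmul σ f (tmul σ r r') = tmul σ q f := by
    rintro r r' ⟨q, hq⟩ ⟨q', hq'⟩
    exact ⟨tmul σ q q', by rw [← tmul_assoc, hq, tmul_assoc, hq', tmul_assoc]⟩
  have hsingle : ∀ (i : ℕ) (c : K), ∃ q, tmul σ f (Finsupp.single i c) = tmul σ q f := by
    intro i
    induction i with
    | zero => exact fun c => h _ (degLt_single (by omega) c)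
    | succ i ih =>
      intro c
      have := hmul _ _ (ih c) (h _ (degLt_single (i := 1) (by omega) 1))
      rwa [tmul_single_single, map_one, mul_one] at this
  have hall : ∀ r : ℕ →₀ K, ∃ q, tmul σ f r = tmul σ q f := by
    intro r
    induction r using Finsupp.induction_linear with
    | zero => exact ⟨0, by rw [tmul_zero, zero_tmul]⟩
    | add r r' hr hr' =>
      obtain ⟨q, hq⟩ := hr
      obtain ⟨q', hq'⟩ := hr'
      exact ⟨q + q', by rw [tmul_add, hq, hq', add_tmul]⟩
    | single i c => exact hsingle i c
  intro q r
  obtain ⟨q', hq'⟩ := hall r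
  exact ⟨tmul σ q q', by rw [tmul_assoc, hq', tmul_assoc]⟩

lemma IsPetitMul.eq_tmul {σ : K ≃ₐ[F] K} {m : ℕ} {f p q : ℕ →₀ K}
    {mul : (ℕ →₀ K) → (ℕ →₀ K) → (ℕ →₀ K)} (hmul : IsPetitMul σ m f mul) (hf : TMonic m f)
    (hp : DegLt m p) (hq : DegLt m q) (hpq : DegLt m (tmul σ p q)) :
    mul p q = tmul σ p q := by
  obtain ⟨h, s, hs⟩ := hmul p q hp hq
  refine hf.remainder_unique (σ := σ) (s := s) (s' := 0) h hpq ?_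
  rw [← hs, zero_tmul, zero_add]

lemma IsPetitMul.single_zero_mul_assoc {σ : K ≃ₐ[F] K} {m : ℕ} {f q r : ℕ →₀ K}
    {mul : (ℕ →₀ K) → (ℕ →₀ K) → (ℕ →₀ K)} (hmul : IsPetitMul σ m f mul) (hf : TMonic m f)
    (hm : 0 < m) (c : K) (hq : DegLt m q) (hr : DegLt m r) :
    mul (mul (Finsupp.single 0 c) q) r = mul (Finsupp.single 0 c) (mul q r) := by
  have hc : DegLt m (Finsupp.single 0 c) := degLt_single hm c
  have hcq : DegLt m (tmul σ (Finsupp.single 0 c) q) := hq.single_zero_tmul c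
  obtain ⟨hb, u, hu⟩ := hmul q r hq hr
  have hcb : DegLt m (tmul σ (Finsupp.single 0 c) (mul q r)) := hb.single_zero_tmul c
  rw [hmul.eq_tmul hf hc hq hcq, hmul.eq_tmul hf hc hb hcb]
  obtain ⟨hx, v, hv⟩ := hmul _ r hcq hr
  refine hf.remainder_unique (σ := σ) hx hcb (s := v)
    (s' := tmul σ (Finsupp.single 0 c) u) ?_
  rw [← hv, tmul_assoc, hu, tmul_add, tmul_assoc]

/-- The left nucleus of a nonassociative Petit algebra consists of constants. -/
lemma IsPetitMul.eq_single_zero_of_assoc {σ : K ≃ₐ[F] K} {m : ℕ} {f p : ℕ →₀ K}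
    {mul : (ℕ →₀ K) → (ℕ →₀ K) → (ℕ →₀ K)} (hmul : IsPetitMul σ m f mul) (hf : TMonic m f)
    (hm : 2 ≤ m) (hri : ¬ RightInvariant σ f) (hp : DegLt m p)
    (hassoc : ∀ q r : ℕ →₀ K, DegLt m q → DegLt m r → mul (mul p q) r = mul p (mul q r)) :
    p = Finsupp.single 0 (p 0) := by
  by_cases hp0 : p = 0
  · simp [hp0]
  obtain ⟨d, hd, hdeg⟩ := exists_apply_ne_zero_degLt hp0
  rcases Nat.eq_zero_or_pos d with rfl | hdpos
  · exact hdeg.eq_single_zero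
  refine absurd (rightInvariant_of_forall_degLt hm fun r hr => ?_) hri
  have hdm : d < m := by
    by_contra h
    exact hd (hp d (by omega))
  have hq : DegLt m (Finsupp.single (m - d) (1 : K)) := degLt_single (by omega) 1
  have hq' : DegLt (m - d + 1) (Finsupp.single (m - d) (1 : K)) := degLt_single (by omega) 1
  obtain ⟨ha, s, hs⟩ := hmul p _ hp hq
  obtain ⟨hb, u, hu⟩ := hmul _ r hq hr
  obtain ⟨-, v, hv⟩ := hmul _ r ha hr
  obtain ⟨-, w, hw⟩ := hmul p _ hp hb
  have hpq : tmul σ p (Finsupp.single (m - d) 1) m = p d := by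
    have := tmul_apply_add_of_degLt σ hdeg hq'
    rwa [Nat.add_sub_cancel' hdm.le, Finsupp.single_eq_same, map_one, mul_one] at this
  have hs1 : DegLt 1 s := by
    apply hf.degLt_of_tmul (σ := σ)
    rw [eq_sub_of_add_eq hs.symm]
    exact (hdeg.tmul hq' (by omega)).sub (ha.mono (by omega))
  have hs0 : s 0 ≠ 0 := by
    intro h0
    rw [hs1.eq_single_zero, h0, Finsupp.single_zero, zero_tmul, zero_add] at hs
    exact hd (by rw [← hpq, hs, ha m le_rfl])
  have key : tmul σ s (tmul σ f r) = tmul σ (tmul σ p u + w - v) f := by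
    rw [hassoc _ r hq hr] at hv
    have h₁ := tmul_assoc σ p (Finsupp.single (m - d) 1) r
    rw [hs, hu, add_tmul, tmul_add, hv, hw, tmul_assoc] at h₁
    rw [sub_tmul, add_tmul, tmul_assoc, eq_sub_iff_add_eq]
    rw [← add_assoc, ← add_assoc] at h₁
    exact add_right_cancel h₁
  refine ⟨tmul σ (Finsupp.single 0 (s 0)⁻¹) (tmul σ p u + w - v), ?_⟩
  rw [tmul_assoc, ← key, ← tmul_assoc, hs1.eq_single_zero, tmul_single_single]
  simp [hs0, one_tmul]

end TwistedPolynomial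

/-- Let `K/F` be cyclic Galois of degree `n ≥ 3`, let
`σ₁ ≠ σ₂` be generators of `Gal(K/F)` with `σ₁ = σ₂^j`, `1 < j < n`,
`gcd(j,n) = 1`. Let `f ∈ K[t;σ₁]`, `g ∈ K[t;σ₂]` be monic of degree `m` with
`n < m - 1`, neither right-invariant, and let `H : S_f → S_g` be an `F`-algebra
isomorphism. Then `H` maps constants to constants inducing some `τ ∈ Gal(K/F)`,
and in `H(t) = Σ_{i<m} k_i t^i` one has `k_i = 0` whenever `i ≢ j (mod n)`. -/
theorem stmt_7 {F K : Type*} [Field F] [Field K] [Algebra F K]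
    [IsGalois F K]
    (n : ℕ) (hdeg : Module.finrank F K = n) (hn : 3 ≤ n)
    (σ₁ σ₂ : K ≃ₐ[F] K)
    (hgen₁ : ∀ τ : K ≃ₐ[F] K, τ ∈ Subgroup.zpowers σ₁)
    (hgen₂ : ∀ τ : K ≃ₐ[F] K, τ ∈ Subgroup.zpowers σ₂)
    (hne : σ₁ ≠ σ₂)
    (j : ℕ) (hj1 : 1 < j) (hjn : j < n) (hjcop : Nat.Coprime j n)
    (hj : σ₁ = σ₂ ^ j)
    (m : ℕ) (hnm : n < m - 1)
    (f g : ℕ →₀ K) (hf : TMonic m f) (hg : TMonic m g)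
    (hfri : ¬ RightInvariant σ₁ f) (hgri : ¬ RightInvariant σ₂ g)
    (mul₁ mul₂ : (ℕ →₀ K) → (ℕ →₀ K) → (ℕ →₀ K))
    (hmul₁ : IsPetitMul σ₁ m f mul₁) (hmul₂ : IsPetitMul σ₂ m g mul₂)
    (H : (ℕ →₀ K) →ₗ[F] (ℕ →₀ K))
    (hmaps : ∀ p : ℕ →₀ K, DegLt m p → DegLt m (H p))
    (hinj : ∀ p q : ℕ →₀ K, DegLt m p → DegLt m q → H p = H q → p = q)
    (hsurj : ∀ q : ℕ →₀ K, DegLt m q → ∃ p : ℕ →₀ K, DegLt m p ∧ H p = q)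
    (hmult : ∀ p q : ℕ →₀ K, DegLt m p → DegLt m q →
      H (mul₁ p q) = mul₂ (H p) (H q)) :
    (∃ τ : K ≃ₐ[F] K, ∀ c : K, H (Finsupp.single 0 c) = Finsupp.single 0 (τ c)) ∧
    ∀ i : ℕ, (H (Finsupp.single 1 1)) i ≠ 0 → i % n = j := by
  have hm : 2 ≤ m := by omega
  have hconst (c : K) : DegLt m (Finsupp.single 0 c) := degLt_single (by omega) c
  have hH (c : K) : H (Finsupp.single 0 c) = Finsupp.single 0 (H (Finsupp.single 0 c) 0) := by
    refine hmul₂.eq_single_zero_of_assoc hg hm hgri (hmaps _ (hconst c)) fun q r hq hr => ?_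
    obtain ⟨q', hq', rfl⟩ := hsurj q hq
    obtain ⟨r', hr', rfl⟩ := hsurj r hr
    rw [← hmult _ _ (hconst c) hq', ← hmult _ _ hq' hr',
      ← hmult _ _ (hmul₁ _ _ (hconst c) hq').1 hr', ← hmult _ _ (hconst c) (hmul₁ _ _ hq' hr').1,
      hmul₁.single_zero_mul_assoc hf (by omega) c hq' hr']
  have hτmul (c d : K) : H (Finsupp.single 0 (c * d)) 0
      = H (Finsupp.single 0 c) 0 * H (Finsupp.single 0 d) 0 := by
    have h := hmult _ _ (hconst c) (hconst d)
    rw [hmul₁.eq_tmul hf (hconst c) (hconst d) ((hconst d).single_zero_tmul c), hH c, hH d,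
      hmul₂.eq_tmul hg (hconst _) (hconst _) ((hconst _).single_zero_tmul _),
      tmul_single_single, tmul_single_single] at h
    simpa using congrArg (fun p => p 0) h
  have hτone : H (Finsupp.single 0 1) 0 = 1 := by
    have h := hτmul 1 1
    rw [mul_one] at h
    refine mul_left_cancel₀ (fun h0 => ?_) (h.symm.trans (mul_one _).symm)
    have h1 := hH 1
    rw [h0, Finsupp.single_zero, ← map_zero H] at h1
    simpa using hinj _ _ (hconst 1) (degLt_zero m) h1
  let φ : K →ₗ[F] K := Finsupp.lapply 0 ∘ₗ H ∘ₗ Finsupp.lsingle 0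
  let ψ : K →ₐ[F] K := AlgHom.ofLinearMap φ hτone hτmul
  have : FiniteDimensional F K := Module.finite_of_finrank_pos (by omega)
  let τ : K ≃ₐ[F] K := AlgEquiv.ofBijective ψ (Algebra.IsAlgebraic.algHom_bijective ψ)
  have hτ (c : K) : H (Finsupp.single 0 c) = Finsupp.single 0 (τ c) := hH c
  refine ⟨⟨τ, hτ⟩, fun i hi => ?_⟩
  have ht : DegLt m (Finsupp.single 1 (1 : K)) := degLt_single (by omega) 1
  have hcoeff (c : K) : H (Finsupp.single 1 1) i * (σ₂ ^ i) (τ c)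
      = τ (σ₁ c) * H (Finsupp.single 1 1) i := by
    have h₁ := hmult _ _ ht (hconst c)
    have h₂ := hmult _ _ (hconst (σ₁ c)) ht
    rw [hmul₁.eq_tmul hf ht (hconst c) (ht.tmul_single_zero c), tmul_single_single, hτ,
      hmul₂.eq_tmul hg (hmaps _ ht) (hconst _) ((hmaps _ ht).tmul_single_zero _)] at h₁
    rw [hmul₁.eq_tmul hf (hconst _) ht (ht.single_zero_tmul _), tmul_single_single, hτ,
      hmul₂.eq_tmul hg (hconst _) (hmaps _ ht) ((hmaps _ ht).single_zero_tmul _)] at h₂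
    rw [← tmul_single_zero_apply, ← single_zero_tmul_apply σ₂, ← h₁, ← h₂]
    simp
  have hcomm : τ * σ₁ = σ₁ * τ := by
    obtain ⟨k, hk⟩ := hgen₁ τ
    rw [← hk]
    exact ((Commute.refl σ₁).zpow_left k).eq
  have hpow : σ₂ ^ i = σ₂ ^ j := by
    rw [← hj]
    ext x
    obtain ⟨c, rfl⟩ := τ.surjective x
    have h := hcoeff c
    rw [mul_comm] at h
    exact (mul_right_cancel₀ hi h).trans (DFunLike.congr_fun hcomm c)
  have hord : orderOf σ₂ = n := by
    rw [orderOf_eq_card_of_forall_mem_zpowers hgen₂, IsGalois.card_aut_eq_finrank, hdeg]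
  have hmod := pow_eq_pow_iff_modEq.1 hpow
  rw [hord] at hmod
  exact Eq.trans hmod (Nat.mod_eq_of_lt hjn)
end

section
/- Let K/F be a cyclic Galois field extension of degree n, let σ be a generator of Gal(K/F), let m ≥ 2, and let a, b ∈ K ∖ F. (1) If n ≥ m−1, then the Petit algebras S_{t^m−a} and S_{t^m−b} (both formed in K[t;σ]) are isomorphic as F-algebras if and only if there exist τ ∈ Gal(K/F) and k ∈ K^× such that τ(a) = (∏_{i=0}^{m−1} σ^i(k))·b. (2) For arbitrary n, if such τ ∈ Gal(K/F) and k ∈ K^× exist, then S_{t^m−a} and S_{t^m−b} are isomorphic as F-algebras. -/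
/-- The multiplication of the Petit algebra `S_{t^m - a} = K[t;σ]/K[t;σ](t^m - a)`,
on the `F`-vector space `Fin m → K` (coordinates with respect to the `K`-basis
`t^0, …, t^{m-1}`). -/
noncomputable def petitMul {F K : Type*} [Field F] [Field K] [Algebra F K]
    (σ : K ≃ₐ[F] K) (a : K) (m : ℕ) (x y : Fin m → K) : Fin m → K :=
  fun l =>
    (∑ i : Fin m, ∑ j : Fin m,
      if (i : ℕ) + (j : ℕ) = (l : ℕ) then x i * (σ ^ (i : ℕ)) (y j) else 0)
    + (∑ i : Fin m, ∑ j : Fin m,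
      if (i : ℕ) + (j : ℕ) = (l : ℕ) + m then
        x i * (σ ^ (i : ℕ)) (y j) * (σ ^ (l : ℕ)) a else 0)

/-- Isomorphism of Petit algebras as `F`-algebras: an `F`-linear bijection
preserving multiplication. -/
def PetitIso {F K : Type*} [Field F] [Field K] [Algebra F K]
    (σ₁ σ₂ : K ≃ₐ[F] K) (a₁ a₂ : K) (m : ℕ) : Prop :=
  ∃ e : (Fin m → K) ≃ₗ[F] (Fin m → K),
    ∀ x y : Fin m → K, e (petitMul σ₁ a₁ m x y) = petitMul σ₂ a₂ m (e x) (e y)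

section PetitAlgebra

variable {F K : Type*} [Field F] [Field K] [Algebra F K]

theorem petitMul_single_right (σ : K ≃ₐ[F] K) (a : K) {m : ℕ} (x : Fin m → K) (j : Fin m)
    (y : K) (l : Fin m) :
    petitMul σ a m x (Pi.single j y) l =
      (∑ i : Fin m, if (i : ℕ) + (j : ℕ) = (l : ℕ) then x i * (σ ^ (i : ℕ)) y else 0)
      + ∑ i : Fin m, if (i : ℕ) + (j : ℕ) = (l : ℕ) + m then
          x i * (σ ^ (i : ℕ)) y * (σ ^ (l : ℕ)) a else 0 := by
  unfold petitMul
  congr 1 <;>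
  · refine Finset.sum_congr rfl fun i _ => ?_
    rw [Finset.sum_eq_single j]
    · simp
    · intro k _ hk
      simp [Pi.single_eq_of_ne hk]
    · simp

theorem petitMul_single_right_of_add_eq (σ : K ≃ₐ[F] K) (a : K) {m : ℕ} (x : Fin m → K)
    {i j l : Fin m} (h : (i : ℕ) + j = l) (y : K) :
    petitMul σ a m x (Pi.single j y) l = x i * (σ ^ (i : ℕ)) y := by
  rw [petitMul_single_right, Finset.sum_eq_single i, Finset.sum_eq_zero]
  · simp [h]
  · intro k _
    rw [if_neg (by omega)]
  · intro k _ hk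
    rw [if_neg (fun hk' => hk (Fin.ext (by omega)))]
  · simp

theorem petitMul_single_right_of_add_eq_add (σ : K ≃ₐ[F] K) (a : K) {m : ℕ} (x : Fin m → K)
    {i j l : Fin m} (h : (i : ℕ) + j = l + m) (y : K) :
    petitMul σ a m x (Pi.single j y) l = x i * (σ ^ (i : ℕ)) y * (σ ^ (l : ℕ)) a := by
  rw [petitMul_single_right, Finset.sum_eq_zero, Finset.sum_eq_single i]
  · simp [h]
  · intro k _ hk
    rw [if_neg (fun hk' => hk (Fin.ext (by omega)))]
  · simp
  · intro k _
    rw [if_neg (by omega)]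

theorem petitMul_single_zero_right (σ : K ≃ₐ[F] K) (a : K) {m : ℕ} (hm : 0 < m)
    (x : Fin m → K) (c : K) (l : Fin m) :
    petitMul σ a m x (Pi.single ⟨0, hm⟩ c) l = x l * (σ ^ (l : ℕ)) c :=
  petitMul_single_right_of_add_eq σ a x (by simp) c

theorem petitMul_smul_left (σ : K ≃ₐ[F] K) (a : K) {m : ℕ} (c : K) (x y : Fin m → K) :
    petitMul σ a m (c • x) y = c • petitMul σ a m x y := by
  ext l
  simp only [petitMul, Pi.smul_apply, smul_eq_mul, mul_add, Finset.mul_sum, mul_ite, mul_zero,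
    mul_assoc]

theorem petitMul_single_zero_left (σ : K ≃ₐ[F] K) (a : K) {m : ℕ} (hm : 0 < m) (c : K)
    (y : Fin m → K) : petitMul σ a m (Pi.single ⟨0, hm⟩ c) y = c • y := by
  ext l
  unfold petitMul
  rw [Finset.sum_eq_single ⟨0, hm⟩, Finset.sum_eq_single l, Finset.sum_eq_zero]
  · simp
  · intro i _
    refine Finset.sum_eq_zero fun j _ => ?_
    split_ifs with h
    · rw [Pi.single_eq_of_ne (by rintro rfl; simp at h; omega)]
      simp
    · rfl
  · intro j _ hj
    rw [if_neg (fun h => hj (Fin.ext (by simpa using h)))]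
  · simp
  · intro i _ hi
    simp [Pi.single_eq_of_ne hi]
  · simp

theorem petitMul_single_single_of_add_eq (σ : K ≃ₐ[F] K) (a : K) {m : ℕ} {i j l : Fin m}
    (h : (i : ℕ) + j = l) (x y : K) :
    petitMul σ a m (Pi.single i x) (Pi.single j y) = Pi.single l (x * (σ ^ (i : ℕ)) y) := by
  ext l'
  by_cases hl : l' = l
  · subst hl
    simp [petitMul_single_right_of_add_eq σ a _ h]
  · rw [petitMul_single_right, Finset.sum_eq_zero, Finset.sum_eq_zero, Pi.single_eq_of_ne hl,
      add_zero]
    all_goals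
      intro k _
      by_cases hk : k = i
      · subst hk
        have : (l' : ℕ) ≠ l := fun h' => hl (Fin.ext h')
        rw [if_neg (by omega)]
      · simp [Pi.single_eq_of_ne hk]

theorem petitMul_single_single_of_add_eq_add (σ : K ≃ₐ[F] K) (a : K) {m : ℕ} {i j l : Fin m}
    (h : (i : ℕ) + j = l + m) (x y : K) :
    petitMul σ a m (Pi.single i x) (Pi.single j y) =
      Pi.single l (x * (σ ^ (i : ℕ)) y * (σ ^ (l : ℕ)) a) := by
  ext l'
  by_cases hl : l' = l
  · subst hl
    simp [petitMul_single_right_of_add_eq_add σ a _ h]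
  · rw [petitMul_single_right, Finset.sum_eq_zero, Finset.sum_eq_zero, Pi.single_eq_of_ne hl,
      add_zero]
    all_goals
      intro k _
      by_cases hk : k = i
      · subst hk
        have : (l' : ℕ) ≠ l := fun h' => hl (Fin.ext h')
        rw [if_neg (by omega)]
      · simp [Pi.single_eq_of_ne hk]

/-- If `σ b ≠ b`, the left nucleus of `S_{t^m - b}` is contained in `K`. -/
theorem apply_eq_zero_of_mem_left_nucleus {σ : K ≃ₐ[F] K} {b : K} (hb : σ b ≠ b) {m : ℕ}
    (hm : 2 ≤ m) {x : Fin m → K}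
    (hx : ∀ y z, petitMul σ b m (petitMul σ b m x y) z = petitMul σ b m x (petitMul σ b m y z))
    {l : Fin m} (hl : (l : ℕ) ≠ 0) : x l = 0 := by
  have h := congrFun (hx (Pi.single ⟨m - 1, by omega⟩ 1) (Pi.single ⟨1, by omega⟩ 1)) l
  have hl' : (l : ℕ) - 1 < m := by omega
  rw [petitMul_single_single_of_add_eq_add σ b (l := ⟨0, by omega⟩) (by simp; omega),
    petitMul_single_zero_right,
    petitMul_single_right_of_add_eq σ b _ (i := ⟨l - 1, hl'⟩) (by simp; omega),
    petitMul_single_right_of_add_eq_add σ b _ (i := l) (by simp; omega)] at h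
  simp only [map_one, mul_one, one_mul, pow_zero, AlgEquiv.one_apply] at h
  by_contra hne
  have h1 := mul_left_cancel₀ hne h
  obtain ⟨p, hp⟩ := Nat.exists_eq_succ_of_ne_zero hl
  rw [hp, Nat.succ_sub_one, pow_succ, AlgEquiv.mul_apply] at h1
  exact hb ((σ ^ p).injective h1).symm

theorem prod_range_add_pow_apply (σ : K ≃ₐ[F] K) (k : K) (i j : ℕ) :
    ∏ l ∈ Finset.range (i + j), (σ ^ l) k =
      (∏ l ∈ Finset.range i, (σ ^ l) k) * (σ ^ i) (∏ l ∈ Finset.range j, (σ ^ l) k) := by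
  rw [Finset.prod_range_add, map_prod]
  simp only [pow_add, AlgEquiv.mul_apply]

/-- The coordinatewise scaling `x t^i ↦ τ(x) (∏_{l < i} σ^l(k)) t^i` is an isomorphism of Petit
algebras as soon as `τ` commutes with `σ` and `τ(a) = (∏_{l < m} σ^l(k)) b`. -/
theorem petitIso_of_eq_prod_mul {σ τ : K ≃ₐ[F] K} (hστ : Commute σ τ) {a b k : K} {m : ℕ}
    (hk : k ≠ 0) (h : τ a = (∏ i ∈ Finset.range m, (σ ^ i) k) * b) : PetitIso σ σ a b m := by
  have hN (i : ℕ) : ∏ l ∈ Finset.range i, (σ ^ l) k ≠ 0 :=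
    Finset.prod_ne_zero_iff.2 fun l _ => (map_ne_zero_iff _ (σ ^ l).injective).2 hk
  have hcomm (i : ℕ) (x : K) : τ ((σ ^ i) x) = (σ ^ i) (τ x) := by
    rw [← AlgEquiv.mul_apply, ← AlgEquiv.mul_apply, (hστ.pow_left i).eq]
  refine ⟨LinearEquiv.piCongrRight fun i : Fin m => τ.toLinearEquiv.trans
    ((LinearEquiv.smulOfNeZero K K _ (hN i)).restrictScalars F), fun x y => ?_⟩
  ext l
  simp only [LinearEquiv.piCongrRight_apply, LinearEquiv.trans_apply, petitMul,
    LinearEquiv.restrictScalars_apply, LinearEquiv.smulOfNeZero_apply, smul_eq_mul,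
    AlgEquiv.toLinearEquiv_apply, map_add, map_sum]
  congr 1
  · refine Finset.sum_congr rfl fun i _ => Finset.sum_congr rfl fun j _ => ?_
    split_ifs with hij
    · rw [← hij, prod_range_add_pow_apply, map_mul, map_mul, hcomm]
      ring
    · simp
  · refine Finset.sum_congr rfl fun i _ => Finset.sum_congr rfl fun j _ => ?_
    split_ifs with hij
    · have h1 := prod_range_add_pow_apply σ k i j
      rw [hij, prod_range_add_pow_apply] at h1
      rw [map_mul, map_mul, map_mul, hcomm, hcomm, h, map_mul]
      linear_combination (τ (x i) * (σ ^ (i : ℕ)) (τ (y j)) * (σ ^ (l : ℕ)) b) * h1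
    · simp

theorem apply_ne_of_notMem_range [IsGalois F K] [FiniteDimensional F K] {σ : K ≃ₐ[F] K}
    (hgen : ∀ τ : K ≃ₐ[F] K, τ ∈ Subgroup.zpowers σ) {a : K}
    (ha : a ∉ Set.range (algebraMap F K)) : σ a ≠ a := by
  intro h
  refine ha ((IsGalois.mem_range_algebraMap_iff_fixed a).2 fun τ => ?_)
  have hle : Subgroup.zpowers σ ≤ MulAction.stabilizer (K ≃ₐ[F] K) a :=
    Subgroup.zpowers_le.2 h
  exact hle (hgen τ)

theorem eq_one_of_pow_eq {G : Type*} [Group G] {g : G} (hg : g ≠ 1) {i : ℕ}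
    (hi : i ≤ orderOf g) (h : g ^ i = g) : i = 1 := by
  rcases hi.lt_or_eq with hlt | rfl
  · have hpos : orderOf g ≠ 1 := fun h1 => hg (orderOf_eq_one_iff.1 h1)
    exact pow_injOn_Iio_orderOf (Set.mem_Iio.2 hlt) (Set.mem_Iio.2 (by omega)) (by simpa using h)
  · exact absurd (by rw [← h, pow_orderOf_eq_one]) hg

/-- When `σ b ≠ b`, an isomorphism between Petit algebras restricts to an automorphism of `K`. -/
theorem exists_algEquiv_of_petitMul_equiv [FiniteDimensional F K] {σ : K ≃ₐ[F] K} {a b : K}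
    (hb : σ b ≠ b) {m : ℕ} (hm : 2 ≤ m) (hm0 : 0 < m) (e : (Fin m → K) ≃ₗ[F] (Fin m → K))
    (he : ∀ x y, e (petitMul σ a m x y) = petitMul σ b m (e x) (e y)) :
    ∃ τ : K ≃ₐ[F] K, ∀ c, e (Pi.single ⟨0, hm0⟩ c) = Pi.single ⟨0, hm0⟩ (τ c) := by
  have key (c : K) : e (Pi.single ⟨0, hm0⟩ c) =
      Pi.single ⟨0, hm0⟩ (e (Pi.single ⟨0, hm0⟩ c) ⟨0, hm0⟩) := by
    ext l
    by_cases hl : l = ⟨0, hm0⟩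
    · subst hl
      simp
    · rw [Pi.single_eq_of_ne hl]
      refine apply_eq_zero_of_mem_left_nucleus hb hm (fun y z => ?_)
        (fun h => hl (Fin.ext h))
      obtain ⟨y, rfl⟩ := e.surjective y
      obtain ⟨z, rfl⟩ := e.surjective z
      simp only [← he, petitMul_single_zero_left, petitMul_smul_left]
  have hone : e (Pi.single ⟨0, hm0⟩ 1) = Pi.single ⟨0, hm0⟩ 1 := by
    obtain ⟨u, hu⟩ := e.surjective (Pi.single ⟨0, hm0⟩ 1)
    have h := he (Pi.single ⟨0, hm0⟩ 1) u
    rw [petitMul_single_zero_left, one_smul, hu] at h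
    refine (h.trans (funext fun l => ?_)).symm
    rw [petitMul_single_zero_right, map_one, mul_one]
  let f : K →ₐ[F] K := AlgHom.ofLinearMap
    (LinearMap.proj ⟨0, hm0⟩ ∘ₗ e.toLinearMap ∘ₗ LinearMap.single F (fun _ => K) ⟨0, hm0⟩)
    (by simp [hone])
    (fun x y => by
      have h := he (Pi.single ⟨0, hm0⟩ x) (Pi.single ⟨0, hm0⟩ y)
      rw [petitMul_single_zero_left, key y, ← Pi.single_smul, smul_eq_mul] at h
      have h0 := congrFun h ⟨0, hm0⟩
      rw [petitMul_single_zero_right] at h0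
      simpa using h0)
  exact ⟨AlgEquiv.ofBijective f f.bijective, key⟩

theorem exists_eq_prod_mul_of_petitIso [FiniteDimensional F K] {σ : K ≃ₐ[F] K} {a b : K}
    (hb : σ b ≠ b) {m : ℕ} (hm : 2 ≤ m) (hord : m - 1 ≤ orderOf σ)
    (hcomm : ∀ τ : K ≃ₐ[F] K, Commute σ τ) (h : PetitIso σ σ a b m) :
    ∃ (τ : K ≃ₐ[F] K) (k : K), k ≠ 0 ∧ τ a = (∏ i ∈ Finset.range m, (σ ^ i) k) * b := by
  obtain ⟨e, he⟩ := h
  have hm0 : 0 < m := by omega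
  have hm1 : 1 < m := hm
  obtain ⟨τ, hτ⟩ := exists_algEquiv_of_petitMul_equiv hb hm hm0 e he
  have hσ : σ ≠ 1 := by
    rintro rfl
    exact hb rfl
  set k : K := e (Pi.single ⟨1, hm1⟩ 1) ⟨1, hm1⟩ with hkdef
  have het : e (Pi.single ⟨1, hm1⟩ 1) = Pi.single ⟨1, hm1⟩ k := by
    ext l
    by_cases hl : l = ⟨1, hm1⟩
    · subst hl
      simp [hkdef]
    rw [Pi.single_eq_of_ne hl]
    by_contra hne
    refine hl (Fin.ext (eq_one_of_pow_eq hσ (by omega) ?_))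
    ext y
    obtain ⟨c, rfl⟩ := τ.surjective y
    have hc : petitMul σ a m (Pi.single ⟨1, hm1⟩ 1) (Pi.single ⟨0, hm0⟩ c) =
        petitMul σ a m (Pi.single ⟨0, hm0⟩ (σ c)) (Pi.single ⟨1, hm1⟩ 1) := by
      rw [petitMul_single_single_of_add_eq σ a (l := ⟨1, hm1⟩) (by simp),
        petitMul_single_single_of_add_eq σ a (l := ⟨1, hm1⟩) (by simp)]
      simp
    have h := congrArg e hc
    rw [he, he, hτ, hτ] at h
    have h1 := congrFun h l
    rw [petitMul_single_zero_right, petitMul_single_zero_left, Pi.smul_apply, smul_eq_mul,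
      mul_comm] at h1
    have h2 := mul_right_cancel₀ hne h1
    rw [h2]
    exact (DFunLike.congr_fun (hcomm τ).eq c).symm
  have hpow (i : ℕ) (hi : i < m) :
      e (Pi.single ⟨i, hi⟩ 1) = Pi.single ⟨i, hi⟩ (∏ l ∈ Finset.range i, (σ ^ l) k) := by
    induction i with
    | zero => simp [hτ]
    | succ i ih =>
      have h1 := he (Pi.single ⟨1, hm1⟩ 1) (Pi.single ⟨i, by omega⟩ 1)
      rw [ih (by omega), het,
        petitMul_single_single_of_add_eq σ a (l := ⟨i + 1, hi⟩) (by simp; omega),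
        petitMul_single_single_of_add_eq σ b (l := ⟨i + 1, hi⟩) (by simp; omega)] at h1
      have h2 := prod_range_add_pow_apply σ k 1 i
      rw [add_comm 1 i] at h2
      rw [h2]
      simpa using h1
  refine ⟨τ, k, fun hk0 => ?_, ?_⟩
  · rw [hk0, Pi.single_zero] at het
    simpa using congrFun (e.map_eq_zero_iff.1 het) ⟨1, hm1⟩
  · have h1 := he (Pi.single ⟨1, hm1⟩ 1) (Pi.single ⟨m - 1, by omega⟩ 1)
    rw [het, hpow,
      petitMul_single_single_of_add_eq_add σ a (l := ⟨0, hm0⟩) (by simp; omega),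
      petitMul_single_single_of_add_eq_add σ b (l := ⟨0, hm0⟩) (by simp; omega), hτ] at h1
    have h2 := congrFun h1 ⟨0, hm0⟩
    have h3 := prod_range_add_pow_apply σ k 1 (m - 1)
    rw [Nat.add_sub_cancel' (by omega)] at h3
    rw [h3]
    simpa using h2

end PetitAlgebra

/-- Let `K/F` be cyclic Galois of degree `n`, `σ` a generator
of `Gal(K/F)`, `m ≥ 2`, `a, b ∈ K ∖ F`. (1) If `n ≥ m-1` then
`S_{t^m-a} ≅ S_{t^m-b}` iff there are `τ ∈ Gal(K/F)` and `k ∈ K^×` with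
`τ(a) = (∏_{i=0}^{m-1} σ^i(k))·b`. (2) For arbitrary `n`, if such `τ`, `k`
exist then `S_{t^m-a} ≅ S_{t^m-b}`. -/
theorem stmt_10 {F K : Type*} [Field F] [Field K] [Algebra F K]
    [IsGalois F K]
    (n m : ℕ) (hdeg : Module.finrank F K = n) (hm : 2 ≤ m)
    (σ : K ≃ₐ[F] K)
    (hgen : ∀ τ : K ≃ₐ[F] K, τ ∈ Subgroup.zpowers σ)
    (a b : K)
    (ha : a ∉ Set.range (algebraMap F K))
    (hb : b ∉ Set.range (algebraMap F K)) :
    (m - 1 ≤ n →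
      (PetitIso σ σ a b m ↔
        ∃ (τ : K ≃ₐ[F] K) (k : K), k ≠ 0 ∧
          τ a = (∏ i ∈ Finset.range m, (σ ^ i) k) * b)) ∧
    ((∃ (τ : K ≃ₐ[F] K) (k : K), k ≠ 0 ∧
        τ a = (∏ i ∈ Finset.range m, (σ ^ i) k) * b) →
      PetitIso σ σ a b m) := by
  have hcomm (τ : K ≃ₐ[F] K) : Commute σ τ := by
    obtain ⟨z, rfl⟩ := Subgroup.mem_zpowers_iff.1 (hgen τ)
    exact Commute.self_zpow σ z
  have hmpr : (∃ (τ : K ≃ₐ[F] K) (k : K), k ≠ 0 ∧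
      τ a = (∏ i ∈ Finset.range m, (σ ^ i) k) * b) → PetitIso σ σ a b m := by
    rintro ⟨τ, k, hk, h⟩
    exact petitIso_of_eq_prod_mul (hcomm τ) hk h
  refine ⟨fun hn => ⟨fun h => ?_, hmpr⟩, hmpr⟩
  have : FiniteDimensional F K := Module.finite_of_finrank_pos (by omega)
  have hord : orderOf σ = n := by
    rw [orderOf_eq_card_of_forall_mem_zpowers hgen, IsGalois.card_aut_eq_finrank, hdeg]
  exact exists_eq_prod_mul_of_petitIso (apply_ne_of_notMem_range hgen hb) hm (by omega) hcomm h
end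

section
/- Let K/F be a cyclic Galois field extension of degree n with generator σ of Gal(K/F), and suppose either m = 2, or m = 3, or m ≥ 5 is prime and F contains a primitive mth root of unity. Let a ∈ K ∖ F. (i) If there is no k ∈ K^× with N_{K/F}(a) = N_{K/F}(k)^m (i.e. N_{K/F}(a) ∉ (N_{K/F}(K^×))^m), then the Petit algebra S_{t^m−a} formed in K[t;σ] is a division algebra. (ii) If F is a finite field and N_{K/F}(a) is not an mth power in F^×, then S_{t^m−a} is a division algebra. -/
section SemilinearDeterminant

variable {F K V : Type*} [Field F] [Field K] [Algebra F K] [AddCommGroup V] [Module K V]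

/-- The matrix of the `k`-th iterate of a `σ`-semilinear map has determinant with norm the `k`-th
power of the norm of a fixed element. -/
theorem exists_matrix_iterate_semilinear {ι : Type*} [Fintype ι] [DecidableEq ι]
    (σ : K ≃ₐ[F] K) (T : V →ₛₗ[(σ : K →+* K)] V) (b : Module.Basis ι K V) :
    ∃ δ : K, ∀ k : ℕ, ∃ B : Matrix ι ι K,
      (∀ j, T^[k] (b j) = ∑ i, B i j • b i) ∧ Algebra.norm F B.det = Algebra.norm F δ ^ k := by
  let A : Matrix ι ι K := Matrix.of fun i j => b.repr (T (b j)) i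
  have hA : ∀ j, T (b j) = ∑ i, A i j • b i := fun j => (b.sum_repr (T (b j))).symm
  refine ⟨A.det, fun k => ?_⟩
  induction k with
  | zero => exact ⟨1, fun j => by simp [Matrix.one_apply], by simp⟩
  | succ k ih =>
    obtain ⟨B, hB, hdet⟩ := ih
    refine ⟨A * (σ : K →+* K).mapMatrix B, fun j => ?_, ?_⟩
    · rw [Function.iterate_succ_apply', hB, map_sum]
      simp only [map_smulₛₗ, hA, Finset.smul_sum, Matrix.mul_apply, Finset.sum_smul]
      rw [Finset.sum_comm]
      refine Finset.sum_congr rfl fun i _ => Finset.sum_congr rfl fun l _ => ?_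
      rw [smul_smul, mul_comm]
      rfl
    · rw [Matrix.det_mul, ← RingHom.map_det, map_mul, pow_succ']
      congr 1
      rw [← hdet]
      exact Algebra.norm_eq_of_algEquiv σ B.det

/-- If some power of a `σ`-semilinear map is diagonal in a spanning family, with all diagonal
entries of norm `c`, then a power of `c` is a power of a norm. -/
theorem exists_norm_pow_eq_of_iterate_eq_smul {ι : Type*} [Finite ι]
    (σ : K ≃ₐ[F] K) (T : V →ₛₗ[(σ : K →+* K)] V) (v : ι → V)
    (hv : Submodule.span K (Set.range v) = ⊤) (m : ℕ) (d : ι → K) (c : F)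
    (hd : ∀ i, Algebra.norm F (d i) = c) (hT : ∀ i, T^[m] (v i) = d i • v i) :
    ∃ δ : K, c ^ Module.finrank K V = Algebra.norm F δ ^ m := by
  classical
  obtain ⟨κ, f, hf, hspan, hli⟩ := exists_linearIndependent' K v
  have : Finite κ := Finite.of_injective f hf
  have := Fintype.ofFinite κ
  let b : Module.Basis κ K V := Module.Basis.mk hli (by rw [hspan, hv])
  obtain ⟨δ, hδ⟩ := exists_matrix_iterate_semilinear σ T b
  obtain ⟨B, hB, hdet⟩ := hδ m
  refine ⟨δ, ?_⟩
  have hBd : B = Matrix.diagonal fun i => d (f i) := by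
    ext i j
    have h : b.repr (T^[m] (b j)) i = B i j := by
      rw [hB, b.repr_sum_self]
    have hb : b j = v (f j) := Module.Basis.mk_apply ..
    rw [← h, hb, hT, ← hb, map_smul, b.repr_self, Finsupp.smul_apply, Matrix.diagonal_apply,
      Finsupp.single_apply]
    by_cases hij : i = j
    · simp [hij]
    · simp [hij, Ne.symm hij]
  rw [← hdet, hBd, Matrix.det_diagonal, map_prod, Module.finrank_eq_card_basis b]
  simp [hd]

end SemilinearDeterminant

theorem exists_norm_pow_of_coprime {F K : Type*} [Field F] [Field K] [Algebra F K]
    [FiniteDimensional F K] {d m : ℕ} (hm : 1 < m) (hdm : Nat.Coprime d m) {a δ : K} (ha : a ≠ 0)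
    (h : Algebra.norm F a ^ d = Algebra.norm F δ ^ m) :
    ∃ k : K, k ≠ 0 ∧ Algebra.norm F a = Algebra.norm F k ^ m := by
  have hna : Algebra.norm F a ≠ 0 := Algebra.norm_ne_zero_iff.mpr ha
  have hδ : δ ≠ 0 := by
    rintro rfl
    rw [Algebra.norm_zero, zero_pow (by omega)] at h
    exact pow_ne_zero _ hna h
  obtain ⟨u, -, hu⟩ := Nat.exists_mul_mod_eq_one_of_coprime hdm hm
  obtain ⟨v, hv⟩ : ∃ v, d * u = m * v + 1 := ⟨d * u / m, by rw [← hu, Nat.div_add_mod]⟩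
  refine ⟨δ ^ u / a ^ v, div_ne_zero (pow_ne_zero _ hδ) (pow_ne_zero _ ha), ?_⟩
  have hk : Algebra.norm F (δ ^ u / a ^ v) * Algebra.norm F a ^ v = Algebra.norm F δ ^ u := by
    rw [← map_pow, ← map_mul, div_mul_cancel₀ _ (pow_ne_zero _ ha), map_pow]
  have hk' := congrArg (· ^ m) hk
  simp only [mul_pow] at hk'
  rw [← pow_mul, ← pow_mul, mul_comm u m, pow_mul _ m u, ← h, ← pow_mul, hv, mul_comm v m,
    pow_succ'] at hk'
  exact (mul_right_cancel₀ (pow_ne_zero _ hna) hk').symm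

section Petit

variable {F K : Type*} [Field F] [Field K] [Algebra F K]

/-- Left multiplication by `t` in the Petit algebra `S_{t^m - a}`. -/
def petitShift (σ : K ≃ₐ[F] K) (a : K) (m : ℕ) :
    (Fin m → K) →ₛₗ[(σ : K →+* K)] (Fin m → K) where
  toFun y l := if (l : ℕ) = 0 then σ (y ⟨m - 1, by have := l.isLt; omega⟩) * a else σ (y ⟨l - 1, by omega⟩)
  map_add' x y := by
    ext l
    by_cases h : (l : ℕ) = 0 <;> simp [h, add_mul]
  map_smul' c y := by
    ext l
    by_cases h : (l : ℕ) = 0 <;> simp [h, mul_assoc]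

theorem petitShift_apply (σ : K ≃ₐ[F] K) (a : K) (m : ℕ) (y : Fin m → K) (l : Fin m) :
    petitShift σ a m y l =
      if (l : ℕ) = 0 then σ (y ⟨m - 1, by have := l.isLt; omega⟩) * a else σ (y ⟨l - 1, by omega⟩) :=
  rfl

theorem petitShift_iterate_apply (σ : K ≃ₐ[F] K) (a : K) (m : ℕ) (y : Fin m → K) (i : ℕ)
    (hi : i ≤ m) : ∀ j l : Fin m,
      (i + (j : ℕ) = l → (petitShift σ a m)^[i] y l = (σ ^ i) (y j)) ∧
      (i + (j : ℕ) = l + m →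
        (petitShift σ a m)^[i] y l = (σ ^ i) (y j) * (σ ^ (l : ℕ)) a) := by
  induction i with
  | zero =>
    refine fun j l => ⟨fun h => ?_, fun h => by omega⟩
    obtain rfl : j = l := Fin.ext (by omega)
    simp
  | succ i ih =>
    intro j l
    rw [Function.iterate_succ_apply', petitShift_apply]
    refine ⟨fun h => ?_, fun h => ?_⟩
    · rw [if_neg (by omega), (ih (by omega) j ⟨l - 1, by omega⟩).1 (by simp only; omega), pow_succ']
      rfl
    · split_ifs with h0
      · rw [(ih (by omega) j ⟨m - 1, by omega⟩).1 (by simp only; omega), pow_succ', h0]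
        rfl
      · obtain ⟨r, hr⟩ : ∃ r, (l : ℕ) = r + 1 := ⟨l - 1, by omega⟩
        rw [(ih (by omega) j ⟨l - 1, by omega⟩).2 (by simp only; omega), map_mul]
        simp only [hr, Nat.add_sub_cancel, pow_succ']
        rfl

theorem petitMul_eq_sum_smul_iterate (σ : K ≃ₐ[F] K) (a : K) (m : ℕ) (x y : Fin m → K) :
    petitMul σ a m x y = ∑ i : Fin m, x i • (petitShift σ a m)^[i] y := by
  ext l
  simp only [petitMul, Finset.sum_apply, Pi.smul_apply, smul_eq_mul]
  rw [← Finset.sum_add_distrib]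
  refine Finset.sum_congr rfl fun i _ => ?_
  rw [← Finset.sum_add_distrib]
  by_cases h : (i : ℕ) ≤ l
  · rw [Finset.sum_eq_single ⟨l - i, by omega⟩,
      (petitShift_iterate_apply σ a m y i (by omega) ⟨l - i, by omega⟩ l).1 (by simp only; omega),
      if_pos (by simp only; omega), if_neg (by simp only; omega), add_zero]
    · intro j _ hj
      rw [if_neg fun h' => hj (Fin.ext (by simp only; omega)), if_neg (by omega), add_zero]
    · simp
  · rw [Finset.sum_eq_single ⟨l + m - i, by omega⟩,
      (petitShift_iterate_apply σ a m y i (by omega) ⟨l + m - i, by omega⟩ l).2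
        (by simp only; omega),
      if_neg (by simp only; omega), if_pos (by simp only; omega), zero_add, mul_assoc]
    · intro j _ hj
      rw [if_neg (by omega), if_neg fun h' => hj (Fin.ext (by simp only; omega)), add_zero]
    · simp

theorem petitShift_iterate_single (σ : K ≃ₐ[F] K) (a : K) (m : ℕ) (i : Fin m) :
    (petitShift σ a m)^[m] (Pi.single i 1) = (σ ^ (i : ℕ)) a • Pi.single i (1 : K) := by
  ext l
  rw [(petitShift_iterate_apply σ a m _ m le_rfl l l).2 (by omega)]
  by_cases h : l = i
  · subst h; simp
  · simp [h]

/-- An invariant subspace of codimension `d` forces `N(a) ^ d` to be the `m`-th power of a norm. -/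
theorem exists_norm_pow_of_invariant (σ : K ≃ₐ[F] K) (a : K) (m : ℕ)
    (W : Submodule K (Fin m → K)) (hW : W ≤ W.comap (petitShift σ a m)) :
    ∃ δ : K, Algebra.norm F a ^ Module.finrank K ((Fin m → K) ⧸ W) = Algebra.norm F δ ^ m := by
  have hit : ∀ (k : ℕ) (y : Fin m → K),
      (W.mapQ W (petitShift σ a m) hW)^[k] (W.mkQ y) = W.mkQ ((petitShift σ a m)^[k] y) := by
    intro k y
    induction k with
    | zero => rfl
    | succ k ih => rw [Function.iterate_succ_apply', Function.iterate_succ_apply', ih]; rfl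
  refine exists_norm_pow_eq_of_iterate_eq_smul σ (W.mapQ W (petitShift σ a m) hW)
    (fun i : Fin m => W.mkQ (Pi.single i 1)) ?_ m (fun i => (σ ^ (i : ℕ)) a) _
    (fun i => Algebra.norm_eq_of_algEquiv (σ ^ (i : ℕ)) a) fun i => ?_
  · have h := (Pi.basisFun K (Fin m)).span_eq
    have h2 := congrArg (Submodule.map W.mkQ) h
    rw [Submodule.map_span, ← Set.range_comp, Submodule.map_top, Submodule.range_mkQ] at h2
    have hcomp : W.mkQ ∘ Pi.basisFun K (Fin m) = fun i => W.mkQ (Pi.single i 1) := by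
      ext i
      simp
    rwa [hcomp] at h2
  · rw [hit, petitShift_iterate_single, map_smul]

/-- A zero divisor in the Petit algebra yields a proper nonzero invariant subspace. -/
theorem exists_invariant_of_petitMul_eq_zero (σ : K ≃ₐ[F] K) (a : K) (m : ℕ) (x y : Fin m → K)
    (h : petitMul σ a m x y = 0) (hx : x ≠ 0) (hy : y ≠ 0) :
    ∃ W : Submodule K (Fin m → K), W ≤ W.comap (petitShift σ a m) ∧ W ≠ ⊥ ∧ W ≠ ⊤ := by
  rw [petitMul_eq_sum_smul_iterate] at h
  set T := petitShift σ a m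
  obtain ⟨e, he, hmax⟩ : ∃ e : Fin m, x e ≠ 0 ∧ ∀ i, e < i → x i = 0 := by
    classical
    have hne : (Finset.univ.filter fun i => x i ≠ 0).Nonempty := by
      obtain ⟨i, hi⟩ := Function.ne_iff.mp hx
      exact ⟨i, by simpa using hi⟩
    obtain ⟨e, he, hmax⟩ := Finset.exists_max_image _ id hne
    refine ⟨e, by simpa using he, fun i hi => ?_⟩
    by_contra hxi
    exact absurd (hmax i (by simpa using hxi)) (not_le.mpr hi)
  let W : Submodule K (Fin m → K) := Submodule.span K (Set.range fun i : Fin e => T^[i] y)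
  have hmem : ∀ i : ℕ, i < e → T^[i] y ∈ W := fun i hi =>
    Submodule.subset_span ⟨⟨i, hi⟩, rfl⟩
  have hlead : T^[e] y ∈ W := by
    have hsum : x e • T^[e] y = -∑ i ∈ Finset.univ.erase e, x i • T^[i] y := by
      rw [← Finset.add_sum_erase _ _ (Finset.mem_univ e)] at h
      exact eq_neg_of_add_eq_zero_left h
    rw [← Submodule.smul_mem_iff W he, hsum]
    refine W.neg_mem (W.sum_mem fun i hi => ?_)
    rcases lt_or_gt_of_ne (Finset.ne_of_mem_erase hi) with hlt | hgt
    · exact W.smul_mem _ (hmem i hlt)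
    · rw [hmax i hgt, zero_smul]
      exact W.zero_mem
  have hyW : y ∈ W := by
    rcases Nat.eq_zero_or_pos (e : ℕ) with h0 | h0
    · simpa [h0] using hlead
    · exact hmem 0 h0
  refine ⟨W, ?_, fun hbot => hy ?_, fun htop => ?_⟩
  · refine Submodule.span_le.mpr ?_
    rintro _ ⟨i, rfl⟩
    change T (T^[i] y) ∈ W
    rw [← Function.iterate_succ_apply' (⇑T)]
    rcases Nat.lt_or_ge (i + 1) e with hlt | hge
    · exact hmem _ hlt
    · rwa [show (i : ℕ).succ = e by omega]
  · rwa [hbot, Submodule.mem_bot] at hyW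
  · have hle : Module.finrank K W ≤ e := by
      exact (finrank_range_le_card (R := K) fun i : Fin e => T^[i] y).trans (Fintype.card_fin _).le
    rw [htop, finrank_top, Module.finrank_fin_fun] at hle
    omega

theorem petitMul_eq_zero_of_prime [FiniteDimensional F K] (σ : K ≃ₐ[F] K) {a : K} (ha : a ≠ 0)
    {m : ℕ} (hm : m.Prime)
    (hnorm : ¬ ∃ k : K, k ≠ 0 ∧ Algebra.norm F a = Algebra.norm F k ^ m) (x y : Fin m → K)
    (h : petitMul σ a m x y = 0) : x = 0 ∨ y = 0 := by
  by_contra! hxy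
  obtain ⟨W, hW, hbot, htop⟩ := exists_invariant_of_petitMul_eq_zero σ a m x y h hxy.1 hxy.2
  obtain ⟨δ, hδ⟩ := exists_norm_pow_of_invariant σ a m W hW
  refine hnorm (exists_norm_pow_of_coprime hm.one_lt ?_ ha hδ)
  have hadd := W.finrank_quotient_add_finrank
  rw [Module.finrank_fin_fun] at hadd
  have hpos : Module.finrank K W ≠ 0 := fun h0 => hbot (Submodule.finrank_eq_zero.mp h0)
  have hlt : Module.finrank K W < m := by
    simpa using Submodule.finrank_lt htop
  exact (Nat.coprime_of_lt_prime (by omega) (by omega) hm).symm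

end Petit

/-- Let `K/F` be cyclic Galois of degree `n` with generator
`σ`, and suppose `m = 2`, or `m = 3`, or `m ≥ 5` is prime and `F` contains a
primitive `m`th root of unity. Let `a ∈ K ∖ F`.
(i) If `N_{K/F}(a) ∉ (N_{K/F}(K^×))^m` then `S_{t^m-a}` is a division algebra.
(ii) If `F` is finite and `N_{K/F}(a)` is not an `m`th power in `F^×`, then
`S_{t^m-a}` is a division algebra. -/
theorem stmt_12 {F K : Type*} [Field F] [Field K] [Algebra F K]
    [IsGalois F K] [FiniteDimensional F K]
    (n m : ℕ) (hdeg : Module.finrank F K = n)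
    (hcase : m = 2 ∨ m = 3 ∨ (5 ≤ m ∧ Nat.Prime m ∧ ∃ ζ : F, IsPrimitiveRoot ζ m))
    (σ : K ≃ₐ[F] K)
    (hgen : ∀ τ : K ≃ₐ[F] K, τ ∈ Subgroup.zpowers σ)
    (a : K) (ha : a ∉ Set.range (algebraMap F K)) :
    ((¬ ∃ k : K, k ≠ 0 ∧ Algebra.norm F a = (Algebra.norm F k) ^ m) →
      ∀ x y : Fin m → K, petitMul σ a m x y = 0 → x = 0 ∨ y = 0) ∧
    (Finite F → (¬ ∃ c : F, c ≠ 0 ∧ Algebra.norm F a = c ^ m) →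
      ∀ x y : Fin m → K, petitMul σ a m x y = 0 → x = 0 ∨ y = 0) := by
  have hm : m.Prime := by
    rcases hcase with rfl | rfl | ⟨-, hm, -⟩
    exacts [Nat.prime_two, Nat.prime_three, hm]
  have ha0 : a ≠ 0 := by
    rintro rfl
    exact ha ⟨0, map_zero _⟩
  refine ⟨petitMul_eq_zero_of_prime σ ha0 hm, fun _ hpow => ?_⟩
  refine petitMul_eq_zero_of_prime σ ha0 hm ?_
  rintro ⟨k, hk, h⟩
  exact hpow ⟨_, Algebra.norm_ne_zero_iff.mpr hk, h⟩
end
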